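/- arXiv:1402.3006 — 2 statements merged into one kernel-verified Lean document; each statement's English description precedes it below -/
import Mathlib

section
/- Let a : [-1,1] × [0,∞) → [0,∞) be continuous, even in the first argument (a(x,v) = a(-x,v)), satisfy condition (C), and be such that for every v ≥ 0 the function x ↦ a(x,v) is nonincreasing on [0,1]. Let F ∈ 𝔉. Then for every nonnegative u ∈ W¹₁(-1,1) one has I(a,u*) ≤ I(a,u). -/
open MeasureTheory Set Filter
open scoped ENNReal BigOperators NNReal

noncomputable section

/-- `u ∈ W¹₁(-1,1)`: `u` is absolutely continuous on `[-1,1]` with (a.e.) derivative in `L¹`,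
encoded via the fundamental theorem of calculus with the pointwise derivative `deriv u`. -/
def MemW11 (u : ℝ → ℝ) : Prop :=
  IntegrableOn (deriv u) (Icc (-1 : ℝ) 1) volume ∧
  ∀ x ∈ Icc (-1 : ℝ) 1, u x = u (-1) + ∫ t in (-1 : ℝ)..x, deriv u t

/-- Convergence `u_k → u` in `W¹₁(-1,1)`. -/
def W11Tendsto (uk : ℕ → ℝ → ℝ) (u : ℝ → ℝ) : Prop :=
  Tendsto (fun k => ∫ x in Icc (-1 : ℝ) 1, (|uk k x - u x| + |deriv (uk k) x - deriv u x|))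
    atTop (nhds 0)

/-- `F ∈ 𝔉`: continuous, nonnegative, convex and nondecreasing in the second argument. -/
def MemFrakF (F : ℝ → ℝ → ℝ) : Prop :=
  ContinuousOn (fun p : ℝ × ℝ => F p.1 p.2) (Ici (0 : ℝ) ×ˢ Ici (0 : ℝ)) ∧
  (∀ v p : ℝ, 0 ≤ v → 0 ≤ p → 0 ≤ F v p) ∧
  (∀ v : ℝ, 0 ≤ v → ConvexOn ℝ (Ici (0 : ℝ)) (F v)) ∧
  (∀ v : ℝ, 0 ≤ v → MonotoneOn (F v) (Ici (0 : ℝ)))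

/-- A continuous nonnegative weight on `[-1,1] × [0,∞)`. -/
def Weight (a : ℝ → ℝ → ℝ) : Prop :=
  ContinuousOn (fun p : ℝ × ℝ => a p.1 p.2) (Icc (-1 : ℝ) 1 ×ˢ Ici (0 : ℝ)) ∧
  ∀ x v : ℝ, x ∈ Icc (-1 : ℝ) 1 → 0 ≤ v → 0 ≤ a x v

/-- Condition (C): `a(s,v) + a(t,v) ≥ a(1 - t + s, v)` for `-1 ≤ s ≤ t ≤ 1`, `v ≥ 0`. -/
def CondC (a : ℝ → ℝ → ℝ) : Prop :=
  ∀ s t v : ℝ, -1 ≤ s → s ≤ t → t ≤ 1 → 0 ≤ v → a (1 - t + s) v ≤ a s v + a t v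

/-- Condition (C) for a one-variable weight. -/
def CondC1 (a : ℝ → ℝ) : Prop :=
  ∀ s t : ℝ, -1 ≤ s → s ≤ t → t ≤ 1 → a (1 - t + s) ≤ a s + a t

/-- Condition (C'): `a(s,v) + a(t,v) ≥ a((s-t)/2, v) + a((t-s)/2, v)`. -/
def CondC' (a : ℝ → ℝ → ℝ) : Prop :=
  ∀ s t v : ℝ, s ∈ Icc (-1 : ℝ) 1 → t ∈ Icc (-1 : ℝ) 1 → 0 ≤ v →
    a ((s - t) / 2) v + a ((t - s) / 2) v ≤ a s v + a t v

/-- The functional `I(a,u) = ∫_{-1}^1 F(u(x), a(x,u(x))·|u'(x)|) dx ∈ [0,∞]`. -/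
def Ifun (F a : ℝ → ℝ → ℝ) (u : ℝ → ℝ) : ℝ≥0∞ :=
  ∫⁻ x in Icc (-1 : ℝ) 1, ENNReal.ofReal (F (u x) (a x (u x) * |deriv u x|))

/-- The monotone rearrangement `u*(x) = ∫₀^∞ χ_{[1-|A_t|,1]}(x) dt`,
where `A_t = {y ∈ [-1,1] : u(y) > t}`. -/
def mrear (u : ℝ → ℝ) (x : ℝ) : ℝ :=
  ∫ t in Ioi (0 : ℝ),
    (Icc (1 - (volume {y ∈ Icc (-1 : ℝ) 1 | u y > t}).toReal) 1).indicator
      (fun _ => (1 : ℝ)) x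

/-- The symmetric rearrangement `ū(x) = ∫₀^∞ χ_{[-|A_t|/2, |A_t|/2]}(x) dt`. -/
def srear (u : ℝ → ℝ) (x : ℝ) : ℝ :=
  ∫ t in Ioi (0 : ℝ),
    (Icc (-((volume {y ∈ Icc (-1 : ℝ) 1 | u y > t}).toReal / 2))
        ((volume {y ∈ Icc (-1 : ℝ) 1 | u y > t}).toReal / 2)).indicator
      (fun _ => (1 : ℝ)) x

/-- `u` is piecewise linear on `[-1,1]`: there is a partition `-1 = x₀ < ⋯ < x_n = 1`
such that `u` is affine on each `[x_i, x_{i+1}]`. -/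
def PiecewiseLinear (u : ℝ → ℝ) : Prop :=
  ∃ n : ℕ, ∃ x : Fin (n + 1) → ℝ, x 0 = -1 ∧ x (Fin.last n) = 1 ∧ StrictMono x ∧
    ∀ i : Fin n, ∃ c d : ℝ, ∀ y ∈ Icc (x i.castSucc) (x i.succ), u y = c * y + d

/-- A function whose increments are controlled by a finite absolutely continuous measure
has Lusin's property (N). -/
theorem volume_image_eq_zero_of_edist_le {f : ℝ → ℝ} {ν : Measure ℝ} [IsFiniteMeasure ν]
    (hν : ν ≪ volume) (hf : ∀ x y, x ≤ y → edist (f x) (f y) ≤ ν (Icc x y))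
    {N : Set ℝ} (hN : volume N = 0) : volume (f '' N) = 0 := by
  have hopen : ∀ O : Set ℝ, IsOpen O → volume (f '' O) ≤ ν O := by
    intro O hO
    let S : Set (Set ℝ) := range fun q : {q : ℚ // (q : ℝ) ∈ O} => connectedComponentIn O (q : ℝ)
    have hScount : S.Countable := countable_range _
    have hSopen : ∀ C ∈ S, IsOpen C := by
      rintro C ⟨q, rfl⟩
      exact hO.connectedComponentIn
    have hSsub : ∀ C ∈ S, C ⊆ O := by
      rintro C ⟨q, rfl⟩
      exact connectedComponentIn_subset _ _
    have hSdisj : S.PairwiseDisjoint id := by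
      rintro C ⟨q, rfl⟩ C' ⟨q', rfl⟩ hne
      by_contra hd
      obtain ⟨z, hz, hz'⟩ := not_disjoint_iff.1 hd
      exact hne ((connectedComponentIn_eq hz).trans (connectedComponentIn_eq hz').symm)
    have hcover : O ⊆ ⋃ C ∈ S, C := by
      intro x hx
      have hxo : IsOpen (connectedComponentIn O x) := hO.connectedComponentIn
      obtain ⟨q, hq⟩ := Rat.denseRange_cast.exists_mem_open hxo ⟨x, mem_connectedComponentIn hx⟩
      have hqO : (q : ℝ) ∈ O := connectedComponentIn_subset _ _ hq
      refine mem_iUnion₂.2 ⟨connectedComponentIn O (q : ℝ), ⟨⟨q, hqO⟩, rfl⟩, ?_⟩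
      rw [← connectedComponentIn_eq hq]
      exact mem_connectedComponentIn hx
    have hcomp : ∀ C ∈ S, volume (f '' C) ≤ ν C := by
      rintro C hC
      have hord : C.OrdConnected := by
        obtain ⟨q, rfl⟩ := hC
        exact isPreconnected_connectedComponentIn.ordConnected
      refine (Real.volume_le_diam _).trans (Metric.ediam_le ?_)
      rintro _ ⟨x, hx, rfl⟩ _ ⟨y, hy, rfl⟩
      rcases le_total x y with h | h
      · exact (hf x y h).trans (measure_mono (hord.out hx hy))
      · rw [edist_comm]
        exact (hf y x h).trans (measure_mono (hord.out hy hx))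
    calc volume (f '' O) ≤ volume (⋃ C ∈ S, f '' C) := by
          refine measure_mono ?_
          rintro _ ⟨x, hx, rfl⟩
          obtain ⟨C, hC, hxC⟩ := mem_iUnion₂.1 (hcover hx)
          exact mem_iUnion₂.2 ⟨C, hC, mem_image_of_mem f hxC⟩
      _ ≤ ∑' C : S, volume (f '' (C : Set ℝ)) := measure_biUnion_le _ hScount _
      _ ≤ ∑' C : S, ν (C : Set ℝ) := ENNReal.tsum_le_tsum fun C => hcomp C C.2
      _ = ν (⋃ C ∈ S, C) :=
          (measure_biUnion hScount hSdisj fun C hC => (hSopen C hC).measurableSet).symm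
      _ ≤ ν O := measure_mono (iUnion₂_subset hSsub)
  refine le_antisymm (ENNReal.le_of_forall_pos_le_add fun ε hε _ => ?_) bot_le
  obtain ⟨O, hNO, hO, hOε⟩ := N.exists_isOpen_lt_of_lt (μ := ν) (ε : ℝ≥0∞) (by
    rw [hν hN]; exact_mod_cast hε)
  simpa using (measure_mono (image_mono hNO)).trans ((hopen O hO).trans hOε.le)

/-- The first point of `[0,1]` at which `f` takes the value `v` (and `1` if there is none). -/
def firstHit (f : ℝ → ℝ) (v : ℝ) : ℝ := sInf (insert 1 {y ∈ Icc (0 : ℝ) 1 | f y = v})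

theorem firstHit_spec {f : ℝ → ℝ} (hf : Continuous f) {v : ℝ} (hv : v ∈ f '' Icc 0 1) :
    firstHit f v ∈ Icc (0 : ℝ) 1 ∧ f (firstHit f v) = v := by
  have hS : insert (1 : ℝ) {y ∈ Icc (0 : ℝ) 1 | f y = v} ⊆ Icc 0 1 :=
    insert_subset (by simp) fun y hy => hy.1
  have hcl : IsClosed {y ∈ Icc (0 : ℝ) 1 | f y = v} :=
    isClosed_Icc.inter (isClosed_eq hf continuous_const)
  have hne : {y ∈ Icc (0 : ℝ) 1 | f y = v}.Nonempty := by
    obtain ⟨y, hy, rfl⟩ := hv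
    exact ⟨y, hy, rfl⟩
  have hbdd : BddBelow {y ∈ Icc (0 : ℝ) 1 | f y = v} := ⟨0, fun y hy => hy.1.1⟩
  have hmem := hcl.csInf_mem hne hbdd
  have heq : firstHit f v = sInf {y ∈ Icc (0 : ℝ) 1 | f y = v} := by
    rw [firstHit, csInf_insert hbdd hne]
    exact min_eq_right hmem.1.2
  rw [heq]
  exact hmem

theorem firstHit_le {f : ℝ → ℝ} {y : ℝ} (hy : y ∈ Icc (0 : ℝ) 1) : firstHit f (f y) ≤ y :=
  csInf_le ⟨0, by rintro z (rfl | hz); exacts [zero_le_one, hz.1.1]⟩ (Or.inr ⟨hy, rfl⟩)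

theorem firstHit_mem (f : ℝ → ℝ) (v : ℝ) : firstHit f v ∈ Icc (0 : ℝ) 1 :=
  ⟨le_csInf ⟨1, Or.inl rfl⟩ (by rintro z (rfl | hz); exacts [zero_le_one, hz.1.1]),
    csInf_le ⟨0, by rintro z (rfl | hz); exacts [zero_le_one, hz.1.1]⟩ (Or.inl rfl)⟩

theorem firstHit_eq_one {f : ℝ → ℝ} {v : ℝ} (hv : v ∉ f '' Icc 0 1) : firstHit f v = 1 := by
  have : {y ∈ Icc (0 : ℝ) 1 | f y = v} = ∅ := by
    ext y
    simp only [mem_ofPred_eq, mem_empty_iff_false, iff_false]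
    exact fun hy => hv ⟨y, hy.1, hy.2⟩
  rw [firstHit, this]
  simp

theorem measurable_firstHit {f : ℝ → ℝ} (hf : Continuous f) : Measurable (firstHit f) := by
  refine measurable_of_Iic fun c => ?_
  rcases lt_or_ge c 0 with hc | hc
  · convert MeasurableSet.empty
    ext v
    simpa using hc.trans_le (firstHit_mem f v).1
  rcases lt_or_ge c 1 with hc1 | hc1
  · have : firstHit f ⁻¹' Iic c = f '' Icc 0 c := by
      ext v
      constructor
      · intro h
        have h' : firstHit f v ≤ c := h
        have hv : v ∈ f '' Icc 0 1 := by
          by_contra hv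
          linarith [firstHit_eq_one hv]
        obtain ⟨h1, h2⟩ := firstHit_spec hf hv
        exact ⟨_, ⟨h1.1, h'⟩, h2⟩
      · rintro ⟨y, hy, rfl⟩
        exact (firstHit_le ⟨hy.1, hy.2.trans hc1.le⟩).trans hy.2
    rw [this]
    exact (isCompact_Icc.image hf).isClosed.measurableSet
  · convert MeasurableSet.univ
    ext v
    simpa using (firstHit_mem f v).2.trans hc1

/-- Lower bound in the area formula which counts only the first point of each level set. -/
theorem lintegral_firstHit_le {f : ℝ → ℝ} (hf : Continuous f)
    (hN : volume (f '' {x | ¬ DifferentiableAt ℝ f x}) = 0) (G : ℝ → ℝ → ℝ≥0∞) :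
    ∫⁻ v in f '' Icc 0 1, G (firstHit f v) v ≤
      ∫⁻ y in Ioo (0 : ℝ) 1, ENNReal.ofReal |deriv f y| * G y (f y) := by
  set Y : Set ℝ := {y ∈ Ioo (0 : ℝ) 1 | DifferentiableAt ℝ f y ∧ firstHit f (f y) = y} with hY
  have hYm : MeasurableSet Y :=
    measurableSet_Ioo.inter ((measurableSet_of_differentiableAt ℝ f).inter
      (measurableSet_eq_fun ((measurable_firstHit hf).comp hf.measurable) measurable_id))
  have hnull : volume (f '' {x | ¬ DifferentiableAt ℝ f x} ∪ {f 0, f 1}) = 0 :=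
    measure_union_null hN ((countable_insert.2 (countable_singleton _)).measure_zero _)
  have hsub : f '' Icc 0 1 ⊆ f '' Y ∪ (f '' {x | ¬ DifferentiableAt ℝ f x} ∪ {f 0, f 1}) := by
    intro v hv
    obtain ⟨h1, h2⟩ := firstHit_spec hf hv
    by_cases hd : DifferentiableAt ℝ f (firstHit f v)
    · rcases h1.1.eq_or_lt with h0 | h0
      · right; right; left; rw [h0]; exact h2.symm
      rcases h1.2.eq_or_lt with h3 | h3
      · right; right; right; rw [mem_singleton_iff, ← h3]; exact h2.symm
      · left
        exact ⟨_, ⟨⟨h0, h3⟩, hd, by rw [h2]⟩, h2⟩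
    · right; left
      exact ⟨_, hd, h2⟩
  calc ∫⁻ v in f '' Icc 0 1, G (firstHit f v) v
      ≤ ∫⁻ v in f '' Y ∪ (f '' {x | ¬ DifferentiableAt ℝ f x} ∪ {f 0, f 1}),
          G (firstHit f v) v := lintegral_mono_set hsub
    _ ≤ (∫⁻ v in f '' Y, G (firstHit f v) v) +
          ∫⁻ v in f '' {x | ¬ DifferentiableAt ℝ f x} ∪ {f 0, f 1}, G (firstHit f v) v :=
        lintegral_union_le _ _ _
    _ = ∫⁻ v in f '' Y, G (firstHit f v) v := by
        rw [setLIntegral_measure_zero _ _ hnull, add_zero]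
    _ = ∫⁻ y in Y, ENNReal.ofReal |deriv f y| * G (firstHit f (f y)) (f y) :=
        lintegral_image_eq_lintegral_abs_deriv_mul hYm
          (fun x hx => hx.2.1.hasDerivAt.hasDerivWithinAt)
          (fun x hx y hy hxy => by rw [← hx.2.2, ← hy.2.2, hxy]) _
    _ = ∫⁻ y in Y, ENNReal.ofReal |deriv f y| * G y (f y) :=
        setLIntegral_congr_fun hYm fun y hy => by simp only [hy.2.2]
    _ ≤ _ := lintegral_mono_set fun y hy => hy.1

/-- Consequence of condition (C) for even weights which are nonincreasing on `[0,1]`. -/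
theorem weight_le_add {b : ℝ → ℝ} (heven : ∀ x ∈ Icc (-1 : ℝ) 1, b x = b (-x))
    (hC : ∀ s t, -1 ≤ s → s ≤ t → t ≤ 1 → b (1 - t + s) ≤ b s + b t)
    (hdec : AntitoneOn b (Icc 0 1)) {m r s : ℝ} (hm : m ∈ Icc (0 : ℝ) 2)
    (hr : r ∈ Icc (0 : ℝ) 1) (hs : s ∈ Icc (0 : ℝ) 1) (h : min m (2 - m) ≤ r + s) :
    b (1 - m) ≤ b (1 - r) + b (1 - s) := by
  obtain ⟨ρ, hρ0, hρ1, hρ, hbρ⟩ : ∃ ρ, 0 ≤ ρ ∧ ρ ≤ 1 ∧ ρ ≤ r + s ∧ b (1 - m) = b (1 - ρ) := by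
    rcases le_total m 1 with h1 | h1
    · exact ⟨m, hm.1, h1, by rwa [min_eq_left (by linarith)] at h, rfl⟩
    · refine ⟨2 - m, by linarith [hm.2], by linarith, by rwa [min_eq_right (by linarith)] at h, ?_⟩
      rw [heven _ ⟨by linarith [hm.2], by linarith⟩]
      congr 1; ring
  obtain ⟨r', s', hr0, hs0, hr', hs', hsum⟩ :
      ∃ r' s', 0 ≤ r' ∧ 0 ≤ s' ∧ r' ≤ r ∧ s' ≤ s ∧ r' + s' = ρ := by
    rcases le_total r ρ with h1 | h1
    · exact ⟨r, ρ - r, hr.1, by linarith, le_rfl, by linarith, by ring⟩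
    · exact ⟨ρ, 0, hρ0, le_rfl, h1, hs.1, by ring⟩
  have h1 : b (1 - r') ≤ b (1 - r) :=
    hdec ⟨by linarith [hr.2], by linarith [hr.1]⟩ ⟨by linarith [hr.2], by linarith⟩ (by linarith)
  have h2 : b (1 - s') ≤ b (1 - s) :=
    hdec ⟨by linarith [hs.2], by linarith [hs.1]⟩ ⟨by linarith [hs.2], by linarith⟩ (by linarith)
  have h3 := hC (s' - 1) (1 - r') (by linarith) (by linarith) (by linarith)
  have h4 : b (1 - (1 - r') + (s' - 1)) = b (1 - ρ) := by
    rw [heven _ ⟨by linarith, by linarith⟩]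
    congr 1; linarith
  have h5 : b (s' - 1) = b (1 - s') := by
    rw [heven _ ⟨by linarith, by linarith⟩]
    congr 1; ring
  rw [hbρ]
  linarith

theorem firstHit_le_of_mem_uIcc {f : ℝ → ℝ} (hf : Continuous f) {x v : ℝ}
    (hx : x ∈ Icc (0 : ℝ) 1) (hv : v ∈ uIcc (f 0) (f x)) : firstHit f v ≤ x := by
  obtain ⟨y, hy, rfl⟩ := intermediate_value_uIcc hf.continuousOn hv
  rw [uIcc_of_le hx.1] at hy
  exact (firstHit_le ⟨hy.1, hy.2.trans hx.2⟩).trans hy.2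

theorem weight_le_single {b : ℝ → ℝ} (heven : ∀ x ∈ Icc (-1 : ℝ) 1, b x = b (-x))
    (hdec : AntitoneOn b (Icc 0 1)) {m r : ℝ} (hm : m ∈ Icc (0 : ℝ) 2)
    (hr : r ∈ Icc (0 : ℝ) 1) (h : min m (2 - m) ≤ r) : b (1 - m) ≤ b (1 - r) := by
  rcases le_total m 1 with h1 | h1
  · rw [min_eq_left (by linarith)] at h
    exact hdec ⟨by linarith [hr.2], by linarith [hr.1]⟩ ⟨by linarith, by linarith [hm.1]⟩
      (by linarith)
  · rw [min_eq_right (by linarith)] at h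
    rw [heven _ ⟨by linarith [hm.2], by linarith⟩]
    exact hdec ⟨by linarith [hr.2], by linarith [hr.1]⟩ ⟨by linarith, by linarith [hm.2]⟩
      (by linarith)

/-- The distribution function of `u` on `[-1,1]`. -/
def distr (u : ℝ → ℝ) (t : ℝ) : ℝ := (volume {y ∈ Icc (-1 : ℝ) 1 | u y > t}).toReal

theorem volume_superlevel_le (u : ℝ → ℝ) (t : ℝ) :
    volume {y ∈ Icc (-1 : ℝ) 1 | u y > t} ≤ 2 := by
  calc volume {y ∈ Icc (-1 : ℝ) 1 | u y > t} ≤ volume (Icc (-1 : ℝ) 1) :=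
        measure_mono fun y hy => hy.1
    _ = 2 := by rw [Real.volume_Icc]; norm_num

theorem ofReal_distr (u : ℝ → ℝ) (t : ℝ) :
    ENNReal.ofReal (distr u t) = volume {y ∈ Icc (-1 : ℝ) 1 | u y > t} :=
  ENNReal.ofReal_toReal ((volume_superlevel_le u t).trans_lt (by simp)).ne

theorem distr_mem (u : ℝ → ℝ) (t : ℝ) : distr u t ∈ Icc (0 : ℝ) 2 :=
  ⟨ENNReal.toReal_nonneg, by
    simpa [distr] using ENNReal.toReal_mono (by simp) (volume_superlevel_le u t)⟩

theorem distr_antitone (u : ℝ → ℝ) : Antitone (distr u) := fun s t hst =>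
  ENNReal.toReal_mono ((volume_superlevel_le u s).trans_lt (by simp)).ne
    (measure_mono fun _ hy => ⟨hy.1, lt_of_le_of_lt hst hy.2⟩)

theorem exists_gt_lt_distr {u : ℝ → ℝ} {c t : ℝ} (h : c < distr u t) :
    ∃ t' > t, c < distr u t' := by
  have hU : {y ∈ Icc (-1 : ℝ) 1 | u y > t} =
      ⋃ n : ℕ, {y ∈ Icc (-1 : ℝ) 1 | u y > t + 1 / ((n : ℝ) + 1)} := by
    ext y
    simp only [mem_iUnion, mem_ofPred_eq, gt_iff_lt]
    constructor
    · rintro ⟨hy, h⟩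
      obtain ⟨n, hn⟩ := exists_nat_one_div_lt (sub_pos.2 h)
      exact ⟨n, hy, by linarith⟩
    · rintro ⟨n, hy, h⟩
      have := Nat.one_div_pos_of_nat (α := ℝ) (n := n)
      exact ⟨hy, by linarith⟩
  have hmono : Monotone fun n : ℕ => {y ∈ Icc (-1 : ℝ) 1 | u y > t + 1 / ((n : ℝ) + 1)} := by
    intro n k hnk y hy
    have := Nat.one_div_le_one_div (α := ℝ) hnk
    have h2 : t + 1 / ((n : ℝ) + 1) < u y := hy.2
    exact ⟨hy.1, show t + 1 / ((k : ℝ) + 1) < u y by linarith⟩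
  have ht := tendsto_measure_iUnion_atTop (μ := volume) hmono
  rw [← hU] at ht
  have ht' := (ENNReal.tendsto_toReal
    ((volume_superlevel_le u t).trans_lt (by simp)).ne).comp ht
  obtain ⟨n, hn⟩ := (ht'.eventually (lt_mem_nhds h)).exists
  exact ⟨_, by have := Nat.one_div_pos_of_nat (α := ℝ) (n := n); linarith, hn⟩

theorem min_distr_le {u : ℝ → ℝ} (hu : Continuous u) (v : ℝ) :
    min (distr u v) (2 - distr u v) ≤
      (1 - firstHit u v) + (1 - firstHit (fun y => u (-y)) v) := by
  have hu' : Continuous fun y => u (-y) := hu.comp continuous_neg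
  have hp := firstHit_mem u v
  have hn := firstHit_mem (fun y => u (-y)) v
  have key : ∀ A : Set ℝ, (∀ x ∈ A, x ∈ Icc (-1 : ℝ) 1 ∧ v ∈ uIcc (u 0) (u x)) →
      (volume A).toReal ≤ (1 - firstHit u v) + (1 - firstHit (fun y => u (-y)) v) := by
    intro A hA
    have hsub : A ⊆ Icc (firstHit u v) 1 ∪ Icc (-1) (-firstHit (fun y => u (-y)) v) := by
      intro x hx
      obtain ⟨h1, h2⟩ := hA x hx
      rcases le_total 0 x with h0 | h0
      · exact Or.inl ⟨firstHit_le_of_mem_uIcc hu ⟨h0, h1.2⟩ h2, h1.2⟩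
      · refine Or.inr ⟨h1.1, ?_⟩
        have := firstHit_le_of_mem_uIcc hu' (x := -x) (v := v)
          ⟨by linarith, by linarith [h1.1]⟩ (by simpa using h2)
        linarith
    have hle : volume A ≤ ENNReal.ofReal
        ((1 - firstHit u v) + (1 - firstHit (fun y => u (-y)) v)) := by
      refine (measure_mono hsub).trans ((measure_union_le _ _).trans ?_)
      rw [Real.volume_Icc, Real.volume_Icc, ENNReal.ofReal_add (by linarith [hp.2])
        (by linarith [hn.2])]
      exact add_le_add le_rfl (ENNReal.ofReal_le_ofReal (by linarith))
    exact ENNReal.toReal_le_of_le_ofReal (by linarith [hp.2, hn.2]) hle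
  rcases le_total (u 0) v with h0 | h0
  · refine (min_le_left _ _).trans (key _ fun x hx => ⟨hx.1, ?_⟩)
    exact mem_uIcc.2 (Or.inl ⟨h0, le_of_lt hx.2⟩)
  · refine (min_le_right _ _).trans ?_
    have hm : MeasurableSet {y ∈ Icc (-1 : ℝ) 1 | u y > v} :=
      measurableSet_Icc.inter (measurableSet_lt measurable_const hu.measurable)
    have hd : volume (Icc (-1 : ℝ) 1 \ {y ∈ Icc (-1 : ℝ) 1 | u y > v}) =
        ENNReal.ofReal (2 - distr u v) := by
      rw [measure_sdiff (fun y hy => hy.1) hm.nullMeasurableSet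
        ((volume_superlevel_le u v).trans_lt (by simp)).ne, ← ofReal_distr, Real.volume_Icc,
        ← ENNReal.ofReal_sub _ (distr_mem u v).1]
      norm_num
    have := key (Icc (-1 : ℝ) 1 \ {y ∈ Icc (-1 : ℝ) 1 | u y > v}) fun x hx => ⟨hx.1, by
      refine mem_uIcc.2 (Or.inr ⟨?_, h0⟩)
      by_contra hlt
      exact hx.2 ⟨hx.1, not_le.1 hlt⟩⟩
    rwa [hd, ENNReal.toReal_ofReal (by linarith [(distr_mem u v).2])] at this

/-- The weight at the end point of the rearranged level set is at most the sum of the weights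
at the two points of the level set closest to the origin. -/
theorem weight_distr_le {a : ℝ → ℝ → ℝ}
    (heven : ∀ x v : ℝ, x ∈ Icc (-1 : ℝ) 1 → 0 ≤ v → a x v = a (-x) v) (hC : CondC a)
    (hdec : ∀ v : ℝ, 0 ≤ v → AntitoneOn (fun x => a x v) (Icc (0 : ℝ) 1))
    {u : ℝ → ℝ} (hu : Continuous u) {v : ℝ} (hv : 0 ≤ v) (hm : distr u v ∈ Ioo (0 : ℝ) 2) :
    ENNReal.ofReal (a (1 - distr u v) v) ≤
      (u '' Icc 0 1).indicator (fun v => ENNReal.ofReal (a (firstHit u v) v)) v +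
      ((fun y => u (-y)) '' Icc 0 1).indicator
        (fun v => ENNReal.ofReal (a (-firstHit (fun y => u (-y)) v) v)) v := by
  have hmin := min_distr_le hu v
  have hp := firstHit_mem u v
  have hn := firstHit_mem (fun y => u (-y)) v
  set h₁ := firstHit u v
  set h₂ := firstHit (fun y => u (-y)) v
  have hm' : distr u v ∈ Icc (0 : ℝ) 2 := distr_mem u v
  have e2 : a (-h₂) v = a h₂ v :=
    (heven h₂ v ⟨by linarith [hn.1], hn.2⟩ hv).symm
  have ev : ∀ x ∈ Icc (-1 : ℝ) 1, a x v = a (-x) v := fun x hx => heven x v hx hv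
  by_cases c1 : v ∈ u '' Icc 0 1 <;> by_cases c2 : v ∈ (fun y => u (-y)) '' Icc 0 1
  · rw [indicator_of_mem c1, indicator_of_mem c2]
    refine le_trans (ENNReal.ofReal_le_ofReal ?_) ENNReal.ofReal_add_le
    have := weight_le_add (b := fun x => a x v) ev
      (fun s t h1 h2 h3 => hC s t v h1 h2 h3 hv) (hdec v hv) hm'
      (r := 1 - h₁) (s := 1 - h₂) ⟨by linarith [hp.2], by linarith [hp.1]⟩
      ⟨by linarith [hn.2], by linarith [hn.1]⟩ hmin
    simp only [sub_sub_cancel] at this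
    change _ ≤ a h₁ v + a (-h₂) v
    rw [e2]
    exact this
  · rw [indicator_of_mem c1, indicator_of_notMem c2, add_zero]
    refine ENNReal.ofReal_le_ofReal ?_
    have h2 : h₂ = 1 := firstHit_eq_one c2
    have := weight_le_single (b := fun x => a x v) ev (hdec v hv) hm'
      (r := 1 - h₁) ⟨by linarith [hp.2], by linarith [hp.1]⟩ (by linarith)
    simpa only [sub_sub_cancel] using this
  · rw [indicator_of_mem c2, indicator_of_notMem c1, zero_add]
    refine ENNReal.ofReal_le_ofReal ?_
    have h2 : h₁ = 1 := firstHit_eq_one c1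
    have := weight_le_single (b := fun x => a x v) ev (hdec v hv) hm'
      (r := 1 - h₂) ⟨by linarith [hn.2], by linarith [hn.1]⟩ (by linarith)
    simp only [sub_sub_cancel] at this
    change _ ≤ a (-h₂) v
    rw [e2]
    exact this
  · exfalso
    have h1 : h₁ = 1 := firstHit_eq_one c1
    have h2 : h₂ = 1 := firstHit_eq_one c2
    have : 0 < min (distr u v) (2 - distr u v) := lt_min hm.1 (by linarith [hm.2])
    linarith

theorem lintegral_weight_distr_le {a : ℝ → ℝ → ℝ} (ham : Measurable (Function.uncurry a))
    (heven : ∀ x v : ℝ, x ∈ Icc (-1 : ℝ) 1 → 0 ≤ v → a x v = a (-x) v) (hC : CondC a)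
    (hdec : ∀ v : ℝ, 0 ≤ v → AntitoneOn (fun x => a x v) (Icc (0 : ℝ) 1))
    {u : ℝ → ℝ} (hu : Continuous u) (hN : volume (u '' {x | ¬ DifferentiableAt ℝ u x}) = 0)
    {g : ℝ → ℝ≥0∞} (hg : Measurable g) {S : Set ℝ} (hSm : MeasurableSet S)
    (hS : ∀ v ∈ S, 0 ≤ v ∧ distr u v ∈ Ioo (0 : ℝ) 2) :
    ∫⁻ v in S, g v * ENNReal.ofReal (a (1 - distr u v) v) ≤
      ∫⁻ y in Ioo (-1 : ℝ) 1,
        ENNReal.ofReal |deriv u y| * (g (u y) * ENNReal.ofReal (a y (u y))) := by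
  set u' : ℝ → ℝ := fun y => u (-y) with hu'def
  have hu' : Continuous u' := hu.comp continuous_neg
  have hN' : volume (u' '' {x | ¬ DifferentiableAt ℝ u' x}) = 0 := by
    refine measure_mono_null ?_ hN
    rintro _ ⟨x, hx, rfl⟩
    refine ⟨-x, fun h => hx ?_, rfl⟩
    exact DifferentiableAt.comp x h differentiableAt_id.neg
  have hi1 : MeasurableSet (u '' Icc 0 1) := (isCompact_Icc.image hu).isClosed.measurableSet
  have hi2 : MeasurableSet (u' '' Icc 0 1) := (isCompact_Icc.image hu').isClosed.measurableSet
  have hmeas : Measurable ((u '' Icc 0 1).indicator fun v =>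
      g v * ENNReal.ofReal (a (firstHit u v) v)) :=
    (hg.mul (ham.comp ((measurable_firstHit hu).prodMk measurable_id)).ennreal_ofReal).indicator
      hi1
  have hneg : ∫⁻ y in Ioo (0 : ℝ) 1,
        ENNReal.ofReal |deriv u' y| * (g (u' y) * ENNReal.ofReal (a (-y) (u' y))) =
      ∫⁻ y in Ioo (-1 : ℝ) 0,
        ENNReal.ofReal |deriv u y| * (g (u y) * ENNReal.ofReal (a y (u y))) := by
    have := (Measure.measurePreserving_neg (volume : Measure ℝ)).setLIntegral_comp_preimage_emb
      (MeasurableEquiv.neg ℝ).measurableEmbedding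
      (fun y => ENNReal.ofReal |deriv u y| * (g (u y) * ENNReal.ofReal (a y (u y))))
      (Ioo (-1 : ℝ) 0)
    rw [← this]
    have hpre : Neg.neg ⁻¹' Ioo (-1 : ℝ) 0 = Ioo (0 : ℝ) 1 := by
      ext x
      simp only [mem_preimage, mem_Ioo]
      constructor <;> rintro ⟨h1, h2⟩ <;> constructor <;> linarith
    rw [hpre]
    refine lintegral_congr fun y => ?_
    rw [hu'def, deriv_comp_neg, abs_neg]
  calc ∫⁻ v in S, g v * ENNReal.ofReal (a (1 - distr u v) v)
      ≤ ∫⁻ v in S, ((u '' Icc 0 1).indicator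
            (fun v => g v * ENNReal.ofReal (a (firstHit u v) v)) v +
          (u' '' Icc 0 1).indicator
            (fun v => g v * ENNReal.ofReal (a (-firstHit u' v) v)) v) := by
        refine setLIntegral_mono' hSm fun v hv => ?_
        rw [indicator_mul_right, indicator_mul_right, ← mul_add]
        gcongr
        exact weight_distr_le heven hC hdec hu (hS v hv).1 (hS v hv).2
    _ ≤ ∫⁻ v, ((u '' Icc 0 1).indicator
            (fun v => g v * ENNReal.ofReal (a (firstHit u v) v)) v +
          (u' '' Icc 0 1).indicator
            (fun v => g v * ENNReal.ofReal (a (-firstHit u' v) v)) v) :=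
        setLIntegral_le_lintegral _ _
    _ = (∫⁻ v in u '' Icc 0 1, g v * ENNReal.ofReal (a (firstHit u v) v)) +
          ∫⁻ v in u' '' Icc 0 1, g v * ENNReal.ofReal (a (-firstHit u' v) v) := by
        rw [lintegral_add_left hmeas, lintegral_indicator hi1, lintegral_indicator hi2]
    _ ≤ (∫⁻ y in Ioo (0 : ℝ) 1,
            ENNReal.ofReal |deriv u y| * (g (u y) * ENNReal.ofReal (a y (u y)))) +
          ∫⁻ y in Ioo (0 : ℝ) 1,
            ENNReal.ofReal |deriv u' y| * (g (u' y) * ENNReal.ofReal (a (-y) (u' y))) :=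
        add_le_add
          (lintegral_firstHit_le hu hN fun y v => g v * ENNReal.ofReal (a y v))
          (lintegral_firstHit_le hu' hN' fun y v => g v * ENNReal.ofReal (a (-y) v))
    _ = ∫⁻ y in Ioo (0 : ℝ) 1 ∪ Ioo (-1 : ℝ) 0,
          ENNReal.ofReal |deriv u y| * (g (u y) * ENNReal.ofReal (a y (u y))) := by
        rw [hneg, lintegral_union measurableSet_Ioo]
        exact disjoint_left.2 fun x hx hx' => lt_asymm hx.1 hx'.2
    _ ≤ _ := by
        refine lintegral_mono_set (union_subset ?_ ?_)
        · exact Ioo_subset_Ioo_left (by norm_num)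
        · exact Ioo_subset_Ioo_right (by norm_num)

theorem mrear_eq_toReal {u : ℝ → ℝ} {x : ℝ} (hx : x ≤ 1) :
    mrear u x = (volume (Ioi (0 : ℝ) ∩ {t | 1 - distr u t ≤ x})).toReal := by
  have hms : MeasurableSet {t | 1 - distr u t ≤ x} :=
    measurableSet_le (measurable_const.sub (distr_antitone u).measurable) measurable_const
  have : ∀ t, (Icc (1 - distr u t) 1).indicator (fun _ => (1 : ℝ)) x =
      {t | 1 - distr u t ≤ x}.indicator (fun _ => (1 : ℝ)) t := by
    intro t
    by_cases h : 1 - distr u t ≤ x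
    · rw [indicator_of_mem (show x ∈ Icc _ _ from ⟨h, hx⟩), indicator_of_mem (by exact h)]
    · rw [indicator_of_notMem (fun h' => h h'.1), indicator_of_notMem (by exact h)]
  change ∫ t in Ioi (0 : ℝ), (Icc (1 - distr u t) 1).indicator (fun _ => (1 : ℝ)) x = _
  simp_rw [this]
  rw [setIntegral_indicator hms]
  simp [Measure.real]

theorem mrear_nonneg (u : ℝ → ℝ) (x : ℝ) : 0 ≤ mrear u x :=
  integral_nonneg fun _ => indicator_nonneg (fun _ _ => zero_le_one) _

theorem distr_eq_zero_of_forall_le {u : ℝ → ℝ} {B : ℝ} (hB : ∀ x ∈ Icc (-1 : ℝ) 1, u x ≤ B) :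
    distr u B = 0 := by
  have : {y ∈ Icc (-1 : ℝ) 1 | u y > B} = ∅ := by
    ext y
    simp only [mem_ofPred_eq, mem_empty_iff_false, iff_false, not_and, not_lt]
    exact hB y
  rw [distr, this]
  simp

theorem le_of_lt_mrear {u : ℝ → ℝ} {x t : ℝ} (hx : x < 1) (ht : 0 ≤ t) (h : t < mrear u x) :
    1 - distr u t ≤ x := by
  by_contra! hlt
  rw [mrear_eq_toReal hx.le] at h
  have hsub : Ioi (0 : ℝ) ∩ {t | 1 - distr u t ≤ x} ⊆ Ioc 0 t := by
    rintro s ⟨hs0, hs⟩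
    refine ⟨hs0, ?_⟩
    by_contra! hts
    have := distr_antitone u hts.le
    have hs' : 1 - distr u s ≤ x := hs
    linarith
  have := ENNReal.toReal_mono (by simp) (measure_mono (μ := volume) hsub)
  rw [Real.volume_Ioc, sub_zero, ENNReal.toReal_ofReal ht] at this
  linarith

theorem lt_mrear {u : ℝ → ℝ} {B : ℝ} (hB : ∀ x ∈ Icc (-1 : ℝ) 1, u x ≤ B) {x t : ℝ}
    (hx : x < 1) (ht : 0 ≤ t) (h : 1 - distr u t < x) : t < mrear u x := by
  obtain ⟨t', htt', ht'⟩ := exists_gt_lt_distr (u := u) (c := 1 - x) (t := t) (by linarith)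
  rw [mrear_eq_toReal hx.le]
  have hfin : volume (Ioi (0 : ℝ) ∩ {t | 1 - distr u t ≤ x}) ≠ ⊤ := by
    have hsub : Ioi (0 : ℝ) ∩ {t | 1 - distr u t ≤ x} ⊆ Icc 0 B := by
      rintro s ⟨hs0, hs⟩
      refine ⟨le_of_lt hs0, ?_⟩
      by_contra! hBs
      have h1 := distr_antitone u hBs.le
      rw [distr_eq_zero_of_forall_le hB] at h1
      have hs' : 1 - distr u s ≤ x := hs
      linarith
    exact ((measure_mono hsub).trans_lt (by simp)).ne
  have hsub : Ioc 0 t' ⊆ Ioi (0 : ℝ) ∩ {t | 1 - distr u t ≤ x} := by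
    intro s hs
    have := distr_antitone u hs.2
    exact ⟨hs.1, show 1 - distr u s ≤ x by linarith⟩
  have := ENNReal.toReal_mono hfin (measure_mono (μ := volume) hsub)
  rw [Real.volume_Ioc, sub_zero, ENNReal.toReal_ofReal (by linarith)] at this
  linarith

theorem monotoneOn_mrear {u : ℝ → ℝ} {B : ℝ} (hB : ∀ x ∈ Icc (-1 : ℝ) 1, u x ≤ B) :
    MonotoneOn (mrear u) (Ioo (-1) 1) := by
  intro x hx y hy hxy
  by_contra! hlt
  have h1 := le_of_lt_mrear hx.2 (mrear_nonneg u y) hlt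
  have hxy' : x < y := lt_of_le_of_ne hxy fun h => by rw [h] at hlt; exact lt_irrefl _ hlt
  exact lt_irrefl _ (lt_mrear hB hy.2 (mrear_nonneg u y) (h1.trans_lt hxy'))

theorem deriv_eq_zero_of_const_Icc {f : ℝ → ℝ} {x y z : ℝ} (hxy : x < y) (hz : z ∈ Icc x y)
    (h : ∀ s ∈ Icc x y, f s = f z) : deriv f z = 0 := by
  by_contra hd
  have h1 : HasDerivWithinAt f (deriv f z) (Icc x y) z :=
    (differentiableAt_of_deriv_ne_zero hd).hasDerivAt.hasDerivWithinAt
  have h2 : HasDerivWithinAt f 0 (Icc x y) z :=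
    (hasDerivWithinAt_const z _ (f z)).congr h rfl
  exact hd ((uniqueDiffOn_Icc hxy z hz).eq_deriv _ h1 h2)

/-- At a point where the rearrangement has nonzero derivative it is the exact inverse of
the distribution function. -/
theorem one_sub_distr_mrear {u : ℝ → ℝ} {B : ℝ} (hB : ∀ x ∈ Icc (-1 : ℝ) 1, u x ≤ B) {x : ℝ}
    (hx : x ∈ Ioo (-1 : ℝ) 1) (hd : deriv (mrear u) x ≠ 0) :
    1 - distr u (mrear u x) = x := by
  have hge : x ≤ 1 - distr u (mrear u x) := by
    by_contra! h
    exact lt_irrefl _ (lt_mrear hB hx.2 (mrear_nonneg u x) h)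
  refine le_antisymm (le_of_forall_gt_imp_ge_of_dense fun y hy => ?_) hge
  rcases le_or_gt 1 y with hy1 | hy1
  · linarith [(distr_mem u (mrear u x)).1]
  have hyI : y ∈ Ioo (-1 : ℝ) 1 := ⟨hx.1.trans hy, hy1⟩
  refine le_of_lt_mrear hy1 (mrear_nonneg u x) ?_
  refine lt_of_le_of_ne (monotoneOn_mrear hB hx hyI hy.le) fun heq => hd ?_
  have hconst : ∀ z ∈ Icc x y, mrear u z = mrear u x := by
    intro z hz
    have hzI : z ∈ Ioo (-1 : ℝ) 1 := ⟨hx.1.trans_le hz.1, hz.2.trans_lt hy1⟩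
    refine le_antisymm ?_ (monotoneOn_mrear hB hx hzI hz.1)
    rw [heq]
    exact monotoneOn_mrear hB hzI hyI hz.2
  exact deriv_eq_zero_of_const_Icc hy ⟨le_rfl, hy.le⟩ hconst

theorem aemeasurable_mrear {u : ℝ → ℝ} {B : ℝ} (hB : ∀ x ∈ Icc (-1 : ℝ) 1, u x ≤ B) :
    AEMeasurable (mrear u) (volume.restrict (Ioo (-1) 1)) :=
  aemeasurable_restrict_of_monotoneOn measurableSet_Ioo (monotoneOn_mrear hB)

theorem map_mrear {u : ℝ → ℝ} (hu : Measurable u) (h0 : ∀ x ∈ Ioo (-1 : ℝ) 1, 0 ≤ u x) {B : ℝ}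
    (hB : ∀ x ∈ Icc (-1 : ℝ) 1, u x ≤ B) :
    (volume.restrict (Ioo (-1) 1)).map (mrear u) = (volume.restrict (Ioo (-1) 1)).map u := by
  have hIoi : ∀ t, (volume.restrict (Ioo (-1) 1)).map (mrear u) (Ioi t) =
      (volume.restrict (Ioo (-1) 1)).map u (Ioi t) := by
    intro t
    rw [Measure.map_apply_of_aemeasurable (aemeasurable_mrear hB) measurableSet_Ioi,
      Measure.map_apply hu measurableSet_Ioi, Measure.restrict_apply' measurableSet_Ioo,
      Measure.restrict_apply' measurableSet_Ioo]
    rcases lt_or_ge t 0 with ht | ht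
    · congr 1
      ext x
      simp only [mem_inter_iff, mem_preimage, mem_Ioi, and_congr_left_iff]
      exact fun hx => ⟨fun _ => ht.trans_le (h0 x hx), fun _ => ht.trans_le (mrear_nonneg u x)⟩
    · have hr : volume (u ⁻¹' Ioi t ∩ Ioo (-1) 1) = ENNReal.ofReal (distr u t) := by
        rw [ofReal_distr]
        have : {y ∈ Icc (-1 : ℝ) 1 | u y > t} = u ⁻¹' Ioi t ∩ Icc (-1) 1 := by
          ext y; exact and_comm
        rw [this]
        exact measure_congr ((ae_eq_refl _).inter Ioo_ae_eq_Icc)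
      rw [hr]
      have hd := distr_mem u t
      apply le_antisymm
      · have hsub : mrear u ⁻¹' Ioi t ∩ Ioo (-1) 1 ⊆ Ico (1 - distr u t) 1 :=
          fun x hx => ⟨le_of_lt_mrear hx.2.2 ht hx.1, hx.2.2⟩
        refine (measure_mono hsub).trans ?_
        rw [Real.volume_Ico, sub_sub_cancel]
      · have hsub : Ioo (1 - distr u t) 1 ⊆ mrear u ⁻¹' Ioi t ∩ Ioo (-1) 1 :=
          fun x hx => ⟨lt_mrear hB hx.2 ht hx.1, by linarith [hx.1, hd.2], hx.2⟩
        refine le_trans ?_ (measure_mono hsub)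
        rw [Real.volume_Ioo, sub_sub_cancel]
  have : IsFiniteMeasure ((volume.restrict (Ioo (-1 : ℝ) 1)).map u) :=
    Measure.isFiniteMeasure_map _ _
  have : IsFiniteMeasure ((volume.restrict (Ioo (-1 : ℝ) 1)).map (mrear u)) :=
    Measure.isFiniteMeasure_map _ _
  have huniv : (volume.restrict (Ioo (-1 : ℝ) 1)).map (mrear u) univ =
      (volume.restrict (Ioo (-1) 1)).map u univ := by
    rw [Measure.map_apply_of_aemeasurable (aemeasurable_mrear hB) MeasurableSet.univ,
      Measure.map_apply hu MeasurableSet.univ, preimage_univ, preimage_univ]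
  refine Measure.ext_of_Iic _ _ fun t => ?_
  rw [← compl_Ioi, measure_compl measurableSet_Ioi (measure_ne_top _ _),
    measure_compl measurableSet_Ioi (measure_ne_top _ _), hIoi, huniv]

theorem lintegral_comp_mrear {u : ℝ → ℝ} (hu : Measurable u)
    (h0 : ∀ x ∈ Ioo (-1 : ℝ) 1, 0 ≤ u x) {B : ℝ} (hB : ∀ x ∈ Icc (-1 : ℝ) 1, u x ≤ B) {g : ℝ → ℝ≥0∞} (hg : Measurable g) :
    ∫⁻ x in Ioo (-1 : ℝ) 1, g (mrear u x) = ∫⁻ x in Ioo (-1 : ℝ) 1, g (u x) := by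
  rw [← lintegral_map' hg.aemeasurable (aemeasurable_mrear hB), map_mrear hu h0 hB,
    lintegral_map hg hu]

/-- The right derivative at `p` of a convex function. -/
def rightSlope (φ : ℝ → ℝ) (p : ℝ) : ℝ :=
  ⨅ n : ℕ, (φ (p + 1 / ((n : ℝ) + 1)) - φ p) / (1 / ((n : ℝ) + 1))

theorem rightSlope_term_nonneg {φ : ℝ → ℝ} (hφ : MonotoneOn φ (Ici 0)) {p : ℝ} (hp : 0 ≤ p)
    (n : ℕ) : 0 ≤ (φ (p + 1 / ((n : ℝ) + 1)) - φ p) / (1 / ((n : ℝ) + 1)) := by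
  have hn := Nat.one_div_pos_of_nat (α := ℝ) (n := n)
  refine div_nonneg (sub_nonneg.2 (hφ hp ?_ (by linarith))) hn.le
  exact mem_Ici.2 (by linarith)

theorem rightSlope_nonneg {φ : ℝ → ℝ} (hφ : MonotoneOn φ (Ici 0)) {p : ℝ} (hp : 0 ≤ p) :
    0 ≤ rightSlope φ p := le_ciInf fun n => rightSlope_term_nonneg hφ hp n

theorem add_rightSlope_mul_le {φ : ℝ → ℝ} (hc : ConvexOn ℝ (Ici 0) φ)
    (hφ : MonotoneOn φ (Ici 0)) {p q : ℝ} (hp : 0 ≤ p) (hq : 0 ≤ q) :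
    φ p + rightSlope φ p * q ≤ φ q + rightSlope φ p * p := by
  have hbdd : BddBelow (range fun n : ℕ =>
      (φ (p + 1 / ((n : ℝ) + 1)) - φ p) / (1 / ((n : ℝ) + 1))) :=
    ⟨0, by rintro _ ⟨n, rfl⟩; exact rightSlope_term_nonneg hφ hp n⟩
  have hpn : ∀ n : ℕ, p + 1 / ((n : ℝ) + 1) ∈ Ici (0 : ℝ) := fun n => by
    have hn := Nat.one_div_pos_of_nat (α := ℝ) (n := n)
    exact mem_Ici.2 (by linarith)
  rcases lt_trichotomy p q with h | rfl | h
  · obtain ⟨n, hn⟩ := exists_nat_one_div_lt (sub_pos.2 h)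
    have hn0 := Nat.one_div_pos_of_nat (α := ℝ) (n := n)
    have h1 : rightSlope φ p ≤ _ := ciInf_le hbdd n
    have h2 := hc.secant_mono hp (hpn n) hq (by linarith) h.ne'
      (by linarith : p + 1 / ((n : ℝ) + 1) ≤ q)
    rw [add_sub_cancel_left] at h2
    have h3 := h1.trans h2
    rw [le_div_iff₀ (sub_pos.2 h)] at h3
    linarith
  · exact le_rfl
  · have h1 : (φ q - φ p) / (q - p) ≤ rightSlope φ p := by
      refine le_ciInf fun n => ?_
      have hn0 := Nat.one_div_pos_of_nat (α := ℝ) (n := n)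
      have h2 := hc.secant_mono hp hq (hpn n) h.ne (by linarith)
        (by linarith : q ≤ p + 1 / ((n : ℝ) + 1))
      rwa [add_sub_cancel_left] at h2
    rw [div_le_iff_of_neg (sub_neg.2 h)] at h1
    linarith

theorem Ifun_eq_Ioo (F a : ℝ → ℝ → ℝ) (u : ℝ → ℝ) :
    Ifun F a u =
      ∫⁻ x in Ioo (-1 : ℝ) 1, ENNReal.ofReal (F (u x) (a x (u x) * |deriv u x|)) := by
  rw [Ifun, Measure.restrict_congr_set Ioo_ae_eq_Icc]

/-- The rearrangement inequality for globally defined measurable data. -/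
theorem Ifun_mrear_le {a F : ℝ → ℝ → ℝ} (ham : Measurable (Function.uncurry a))
    (ha0 : ∀ x v, 0 ≤ a x v)
    (heven : ∀ x v : ℝ, x ∈ Icc (-1 : ℝ) 1 → 0 ≤ v → a x v = a (-x) v) (hC : CondC a)
    (hdec : ∀ v : ℝ, 0 ≤ v → AntitoneOn (fun x => a x v) (Icc (0 : ℝ) 1))
    (hFm : Measurable (Function.uncurry F)) (hF : MemFrakF F)
    {u : ℝ → ℝ} (hu : Continuous u) (h0 : ∀ x ∈ Ioo (-1 : ℝ) 1, 0 ≤ u x)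
    (hN : volume (u '' {x | ¬ DifferentiableAt ℝ u x}) = 0) :
    Ifun F a (mrear u) ≤ Ifun F a u := by
  obtain ⟨-, hF0, hFc, hFmono⟩ := hF
  obtain ⟨B, hB'⟩ := (isCompact_Icc (a := (-1 : ℝ)) (b := 1)).bddAbove_image hu.continuousOn
  have hB : ∀ x ∈ Icc (-1 : ℝ) 1, u x ≤ B := fun x hx => hB' (mem_image_of_mem u hx)
  set w := mrear u with hw
  have hw0 : ∀ x, 0 ≤ w x := mrear_nonneg u
  set D : Set ℝ := {x ∈ Ioo (-1 : ℝ) 1 | deriv w x ≠ 0} with hD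
  have hDm : MeasurableSet D :=
    measurableSet_Ioo.inter (measurable_deriv w (measurableSet_singleton 0).compl)
  have hinv : ∀ x ∈ D, 1 - distr u (w x) = x := fun x hx => one_sub_distr_mrear hB hx.1 hx.2
  have hinj : InjOn w D := fun x hx y hy hxy => by rw [← hinv x hx, ← hinv y hy, hxy]
  have hderiv : ∀ x ∈ D, HasDerivWithinAt w (deriv w x) D x := fun x hx =>
    (differentiableAt_of_deriv_ne_zero hx.2).hasDerivAt.hasDerivWithinAt
  have hVm : MeasurableSet (w '' D) :=
    measurable_image_of_fderivWithin hDm (fun x hx => (hderiv x hx).hasFDerivWithinAt) hinj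
  have hdm : Measurable fun v => 1 - distr u v :=
    measurable_const.sub (distr_antitone u).measurable
  set p : ℝ → ℝ := (w '' D).indicator
    fun v => a (1 - distr u v) v * |deriv w (1 - distr u v)| with hp
  have hpm : Measurable p := by
    refine Measurable.indicator (Measurable.mul (ham.comp (hdm.prodMk measurable_id)) ?_) hVm
    exact measurable_norm.comp ((measurable_deriv w).comp hdm)
  have hp0 : ∀ v, 0 ≤ p v := fun v =>
    indicator_nonneg (fun v _ => mul_nonneg (ha0 _ _) (abs_nonneg _)) v
  have hpD : ∀ x ∈ D, p (w x) = a x (w x) * |deriv w x| := fun x hx => by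
    rw [hp, indicator_of_mem (mem_image_of_mem w hx), hinv x hx]
  have hpnD : ∀ x ∈ Ioo (-1 : ℝ) 1, x ∉ D → p (w x) = 0 ∧ deriv w x = 0 := fun x hx hxD => by
    have hd : deriv w x = 0 := by
      by_contra h
      exact hxD ⟨hx, h⟩
    refine ⟨?_, hd⟩
    by_cases hV : w x ∈ w '' D
    · obtain ⟨y, hy, hyx⟩ := hV
      refine absurd hyx ?_
      rcases lt_trichotomy x y with hxy | rfl | hxy
      · refine fun hyx => hy.2 (deriv_eq_zero_of_const_Icc hxy ⟨hxy.le, le_rfl⟩ fun s hs => ?_)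
        have hsI : s ∈ Ioo (-1 : ℝ) 1 := ⟨hx.1.trans_le hs.1, hs.2.trans_lt hy.1.2⟩
        exact le_antisymm (monotoneOn_mrear hB hsI hy.1 hs.2)
          (hyx.le.trans (monotoneOn_mrear hB hx hsI hs.1))
      · exact absurd hy hxD
      · exact (lt_mrear hB hx.2 (hw0 y) (by rw [hinv y hy]; exact hxy)).ne
    · rw [hp, indicator_of_notMem hV]
  have hpw : ∀ x ∈ Ioo (-1 : ℝ) 1, p (w x) = a x (w x) * |deriv w x| := fun x hx => by
    by_cases hxD : x ∈ D
    · exact hpD x hxD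
    · rw [(hpnD x hx hxD).1, (hpnD x hx hxD).2, abs_zero, mul_zero]
  set β : ℝ → ℝ := fun v => rightSlope (F v) (p v) with hβ
  have hβm : Measurable β := by
    refine Measurable.iInf fun n => Measurable.div_const (Measurable.sub ?_ ?_) _
    · exact hFm.comp (measurable_id.prodMk (hpm.add_const _))
    · exact hFm.comp (measurable_id.prodMk hpm)
  have hβ0 : ∀ v, 0 ≤ v → 0 ≤ β v := fun v hv => rightSlope_nonneg (hFmono v hv) (hp0 v)
  set H : ℝ → ℝ≥0∞ := fun v => ENNReal.ofReal (F v (p v)) with hH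
  have hHm : Measurable H := (hFm.comp (measurable_id.prodMk hpm)).ennreal_ofReal
  set E : ℕ → Set ℝ := fun n => {v | β v * p v ≤ n} with hE
  have hEm : ∀ n, MeasurableSet (E n) := fun n => measurableSet_le (hβm.mul hpm) measurable_const
  have hmain : ∀ n, ∫⁻ x in Ioo (-1 : ℝ) 1, (E n).indicator H (u x) ≤ Ifun F a u := by
    intro n
    set g : ℝ → ℝ≥0∞ := (E n).indicator fun v => ENNReal.ofReal (β v) with hg
    set k : ℝ → ℝ≥0∞ := (E n).indicator fun v => ENNReal.ofReal (β v * p v) with hk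
    have hgm : Measurable g := hβm.ennreal_ofReal.indicator (hEm n)
    have hkm : Measurable k := (hβm.mul hpm).ennreal_ofReal.indicator (hEm n)
    have hkle : ∀ v, k v ≤ n := fun v => by
      by_cases hv : v ∈ E n
      · rw [hk, indicator_of_mem hv]
        have hv' : β v * p v ≤ n := hv
        exact ENNReal.ofReal_le_of_le_toReal (by simpa using hv')
      · rw [hk, indicator_of_notMem hv]
        exact bot_le
    have hJ : ∫⁻ x in Ioo (-1 : ℝ) 1, k (u x) ≠ ⊤ := by
      refine ((lintegral_mono fun x => hkle (u x)).trans_lt ?_).ne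
      rw [setLIntegral_const]
      exact ENNReal.mul_lt_top (by simp) (by simp)
    have hJle : ∫⁻ x in Ioo (-1 : ℝ) 1, k (u x) ≤ ∫⁻ y in Ioo (-1 : ℝ) 1,
        ENNReal.ofReal |deriv u y| * (g (u y) * ENNReal.ofReal (a y (u y))) := by
      calc ∫⁻ x in Ioo (-1 : ℝ) 1, k (u x) = ∫⁻ x in Ioo (-1 : ℝ) 1, k (w x) :=
            (lintegral_comp_mrear hu.measurable h0 hB hkm).symm
        _ ≤ ∫⁻ x in Ioo (-1 : ℝ) 1, D.indicator (fun x => ENNReal.ofReal |deriv w x| *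
              (g (w x) * ENNReal.ofReal (a (1 - distr u (w x)) (w x)))) x := by
            refine setLIntegral_mono' measurableSet_Ioo fun x hx => ?_
            by_cases hxE : w x ∈ E n
            · by_cases hxD : x ∈ D
              · rw [indicator_of_mem hxD, hk, hg, indicator_of_mem hxE, indicator_of_mem hxE,
                  hpD x hxD, hinv x hxD, ENNReal.ofReal_mul (hβ0 _ (hw0 x)),
                  ENNReal.ofReal_mul (ha0 _ _)]
                exact le_of_eq (by ring)
              · rw [hk, indicator_of_mem hxE, (hpnD x hx hxD).1]
                simp
            · rw [hk, indicator_of_notMem hxE]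
              exact bot_le
        _ ≤ ∫⁻ x in D, ENNReal.ofReal |deriv w x| *
              (g (w x) * ENNReal.ofReal (a (1 - distr u (w x)) (w x))) := by
            rw [← lintegral_indicator hDm]
            exact setLIntegral_le_lintegral _ _
        _ = ∫⁻ v in w '' D, g v * ENNReal.ofReal (a (1 - distr u v) v) :=
            (lintegral_image_eq_lintegral_abs_deriv_mul hDm hderiv hinj
              fun v => g v * ENNReal.ofReal (a (1 - distr u v) v)).symm
        _ ≤ _ := by
            refine lintegral_weight_distr_le ham heven hC hdec hu hN hgm hVm ?_
            rintro _ ⟨x, hx, rfl⟩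
            have h1 := hinv x hx
            exact ⟨hw0 x, by linarith [hx.1.2], by linarith [hx.1.1]⟩
    refine ENNReal.le_of_add_le_add_right hJ ?_
    calc (∫⁻ x in Ioo (-1 : ℝ) 1, (E n).indicator H (u x)) + ∫⁻ x in Ioo (-1 : ℝ) 1, k (u x)
        ≤ (∫⁻ x in Ioo (-1 : ℝ) 1, (E n).indicator H (u x)) + ∫⁻ y in Ioo (-1 : ℝ) 1,
            ENNReal.ofReal |deriv u y| * (g (u y) * ENNReal.ofReal (a y (u y))) :=
          add_le_add le_rfl hJle
      _ = ∫⁻ y in Ioo (-1 : ℝ) 1, ((E n).indicator H (u y) +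
            ENNReal.ofReal |deriv u y| * (g (u y) * ENNReal.ofReal (a y (u y)))) :=
          (lintegral_add_left ((hHm.indicator (hEm n)).comp hu.measurable) _).symm
      _ ≤ ∫⁻ y in Ioo (-1 : ℝ) 1,
            (ENNReal.ofReal (F (u y) (a y (u y) * |deriv u y|)) + k (u y)) := by
          refine setLIntegral_mono' measurableSet_Ioo fun y hy => ?_
          have hv := h0 y hy
          by_cases hyE : u y ∈ E n
          · have hq : 0 ≤ a y (u y) * |deriv u y| := mul_nonneg (ha0 _ _) (abs_nonneg _)
            have hb := hβ0 _ hv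
            rw [hk, hg, indicator_of_mem hyE, indicator_of_mem hyE, indicator_of_mem hyE,
              ← ENNReal.ofReal_mul hb, ← ENNReal.ofReal_mul (abs_nonneg _),
              ← ENNReal.ofReal_add (hF0 _ _ hv (hp0 _))
                (mul_nonneg (abs_nonneg _) (mul_nonneg hb (ha0 _ _))),
              ← ENNReal.ofReal_add (hF0 _ _ hv hq) (mul_nonneg hb (hp0 _))]
            refine ENNReal.ofReal_le_ofReal ?_
            have := add_rightSlope_mul_le (hFc _ hv) (hFmono _ hv) (hp0 (u y)) hq
            calc _ = F (u y) (p (u y)) + β (u y) * (a y (u y) * |deriv u y|) := by ring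
              _ ≤ _ := this
          · rw [hk, hg, indicator_of_notMem hyE, indicator_of_notMem hyE]
            simp
      _ = Ifun F a u + ∫⁻ x in Ioo (-1 : ℝ) 1, k (u x) := by
          rw [lintegral_add_right _ (show Measurable fun x => k (u x) from hkm.comp hu.measurable),
            Ifun_eq_Ioo]
  calc Ifun F a w = ∫⁻ x in Ioo (-1 : ℝ) 1, H (w x) := by
        rw [Ifun_eq_Ioo]
        exact setLIntegral_congr_fun measurableSet_Ioo fun x hx => by
          simp only [hH, hpw x hx]
    _ = ∫⁻ x in Ioo (-1 : ℝ) 1, H (u x) := lintegral_comp_mrear hu.measurable h0 hB hHm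
    _ = ∫⁻ x in Ioo (-1 : ℝ) 1, ⨆ n, (E n).indicator H (u x) := by
        refine lintegral_congr fun x => le_antisymm ?_
          (iSup_le fun n => indicator_le_self _ _ _)
        obtain ⟨n, hn⟩ := exists_nat_ge (β (u x) * p (u x))
        refine le_iSup_of_le n ?_
        rw [indicator_of_mem (show u x ∈ E n from hn)]
    _ = ⨆ n, ∫⁻ x in Ioo (-1 : ℝ) 1, (E n).indicator H (u x) := by
        refine lintegral_iSup (fun n => (hHm.indicator (hEm n)).comp hu.measurable) ?_
        intro n k hnk x
        refine indicator_le_indicator_of_subset (fun v hv => ?_) (fun _ => bot_le) _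
        exact le_trans (show β v * p v ≤ n from hv) (by exact_mod_cast hnk)
    _ ≤ Ifun F a u := iSup_le hmain

theorem mrear_congr {u U : ℝ → ℝ} (h : EqOn u U (Icc (-1) 1)) : mrear u = mrear U := by
  have : ∀ t, {y ∈ Icc (-1 : ℝ) 1 | u y > t} = {y ∈ Icc (-1 : ℝ) 1 | U y > t} := fun t => by
    ext y
    simp only [mem_ofPred_eq, and_congr_right_iff]
    intro hy
    rw [h hy]
  funext x
  simp only [mrear, this]

theorem Ifun_congr {F a F' a' : ℝ → ℝ → ℝ} {u U : ℝ → ℝ} (h : EqOn u U (Ioo (-1) 1))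
    (h0 : ∀ x ∈ Ioo (-1 : ℝ) 1, 0 ≤ u x)
    (ha0 : ∀ x ∈ Ioo (-1 : ℝ) 1, ∀ v, 0 ≤ v → 0 ≤ a x v)
    (ha : ∀ x ∈ Ioo (-1 : ℝ) 1, ∀ v, 0 ≤ v → a x v = a' x v)
    (hF : ∀ v p, 0 ≤ v → 0 ≤ p → F v p = F' v p) : Ifun F a u = Ifun F' a' U := by
  rw [Ifun_eq_Ioo, Ifun_eq_Ioo]
  refine setLIntegral_congr_fun measurableSet_Ioo fun x hx => ?_
  have hd : deriv u x = deriv U x :=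
    (Filter.eventuallyEq_of_mem (Ioo_mem_nhds hx.1 hx.2) h).deriv_eq
  rw [hF _ _ (h0 x hx) (mul_nonneg (ha0 x hx _ (h0 x hx)) (abs_nonneg _)),
    ha x hx _ (h0 x hx), hd, h hx]

/-- A function in `W¹₁(-1,1)` has a continuous extension with Lusin's property (N). -/
theorem MemW11.exists_extension {u : ℝ → ℝ} (hu : MemW11 u) :
    ∃ U : ℝ → ℝ, Continuous U ∧ EqOn u U (Icc (-1) 1) ∧
      volume (U '' {x | ¬ DifferentiableAt ℝ U x}) = 0 := by
  obtain ⟨hi, hu⟩ := hu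
  set g : ℝ → ℝ := (Icc (-1 : ℝ) 1).indicator (deriv u) with hg
  have hgi : Integrable g := hi.integrable_indicator measurableSet_Icc
  have hii : ∀ x y : ℝ, IntervalIntegrable g volume x y := fun x y => hgi.intervalIntegrable
  refine ⟨fun x => u (-1) + ∫ t in (-1 : ℝ)..x, g t,
    continuous_const.add (intervalIntegral.continuous_primitive hii _), fun x hx => ?_, ?_⟩
  · simp only
    rw [hu x hx]
    congr 1
    refine intervalIntegral.integral_congr fun t ht => ?_
    rw [uIcc_of_le hx.1] at ht
    rw [hg, indicator_of_mem (show t ∈ Icc (-1 : ℝ) 1 from ⟨ht.1, ht.2.trans hx.2⟩)]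
  · have : IsFiniteMeasure (volume.withDensity fun t => ‖g t‖ₑ) :=
      isFiniteMeasure_withDensity hgi.2.ne
    refine volume_image_eq_zero_of_edist_le (ν := volume.withDensity fun t => ‖g t‖ₑ)
      (withDensity_absolutelyContinuous _ _) (fun x y hxy => ?_) ?_
    · rw [edist_comm, edist_eq_enorm_sub, add_sub_add_left_eq_sub,
        intervalIntegral.integral_interval_sub_left (hii _ _) (hii _ _),
        intervalIntegral.integral_of_le hxy, withDensity_apply _ measurableSet_Icc]
      exact (enorm_integral_le_lintegral_enorm _).trans (lintegral_mono_set Ioc_subset_Icc_self)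
    · have := LocallyIntegrable.ae_hasDerivAt_integral hgi.locallyIntegrable
      refine ae_iff.1 (this.mono fun x hx => ?_)
      exact ((hx (-1)).const_add _).differentiableAt

/-- the rearrangement inequality for all nonnegative `u ∈ W¹₁(-1,1)` when the
even weight satisfying (C) is nonincreasing on `[0,1]`. -/
theorem stmt13 (a F : ℝ → ℝ → ℝ) (ha : Weight a)
    (heven : ∀ x v : ℝ, x ∈ Icc (-1 : ℝ) 1 → 0 ≤ v → a x v = a (-x) v)
    (hC : CondC a)
    (hdec : ∀ v : ℝ, 0 ≤ v → AntitoneOn (fun x => a x v) (Icc (0 : ℝ) 1))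
    (hF : MemFrakF F)
    (u : ℝ → ℝ) (hu : MemW11 u) (hnn : ∀ x ∈ Icc (-1 : ℝ) 1, 0 ≤ u x) :
    Ifun F a (mrear u) ≤ Ifun F a u := by
  obtain ⟨hac, ha0⟩ := ha
  have ⟨hFc, hF0, hFconv, hFmono⟩ := hF
  obtain ⟨U, hUc, hUeq, hUN⟩ := hu.exists_extension
  set c : ℝ → ℝ := fun x => max (-1) (min x 1) with hc
  have hcmem : ∀ x, c x ∈ Icc (-1 : ℝ) 1 := fun x =>
    ⟨le_max_left _ _, max_le (by norm_num) (min_le_right _ _)⟩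
  have hceq : ∀ x ∈ Icc (-1 : ℝ) 1, c x = x := fun x hx => by
    simp only [hc, min_eq_left hx.2, max_eq_right hx.1]
  set a' : ℝ → ℝ → ℝ := fun x v => a (c x) (max v 0) with ha'
  set F' : ℝ → ℝ → ℝ := fun v p => F (max v 0) (max p 0) with hF'
  have haeq : ∀ x ∈ Icc (-1 : ℝ) 1, ∀ v, 0 ≤ v → a x v = a' x v := fun x hx v hv => by
    simp only [ha', hceq x hx, max_eq_left hv]
  have hFeq : ∀ v p, 0 ≤ v → 0 ≤ p → F v p = F' v p := fun v p hv hp => by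
    simp only [hF', max_eq_left hv, max_eq_left hp]
  have hFeqOn : ∀ v, 0 ≤ v → EqOn (F v) (F' v) (Ici 0) := fun v hv p hp => hFeq v p hv hp
  have ham : Measurable (Function.uncurry a') := by
    refine (hac.comp_continuous (f := fun q : ℝ × ℝ => (c q.1, max q.2 0)) ?_
      fun q => ⟨hcmem _, mem_Ici.2 (le_max_right _ _)⟩).measurable
    fun_prop
  have hF'c : Continuous (Function.uncurry F') := by
    refine hFc.comp_continuous (f := fun q : ℝ × ℝ => (max q.1 0, max q.2 0)) ?_
      fun q => ⟨mem_Ici.2 (le_max_right _ _), mem_Ici.2 (le_max_right _ _)⟩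
    fun_prop
  have hneg : ∀ x ∈ Icc (-1 : ℝ) 1, -x ∈ Icc (-1 : ℝ) 1 := fun x hx =>
    ⟨by linarith [hx.2], by linarith [hx.1]⟩
  have hIoo : ∀ x ∈ Ioo (-1 : ℝ) 1, x ∈ Icc (-1 : ℝ) 1 := fun x hx => Ioo_subset_Icc_self hx
  have hmain : Ifun F' a' (mrear U) ≤ Ifun F' a' U := by
    refine Ifun_mrear_le ham (fun x v => ha0 _ _ (hcmem x) (le_max_right _ _))
      (fun x v hx hv => ?_) (fun s t v h1 h2 h3 hv => ?_) (fun v hv x hx y hy hxy => ?_)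
      hF'c.measurable
      ⟨hF'c.continuousOn, fun v p _ _ => hF0 _ _ (le_max_right _ _) (le_max_right _ _),
        fun v hv => (hFconv v hv).congr (hFeqOn v hv),
        fun v hv => (hFmono v hv).congr (hFeqOn v hv)⟩ hUc
      (fun x hx => by rw [← hUeq (hIoo x hx)]; exact hnn x (hIoo x hx)) hUN
    · rw [← haeq x hx v hv, ← haeq _ (hneg x hx) v hv]
      exact heven x v hx hv
    · rw [← haeq _ ⟨by linarith, by linarith⟩ v hv, ← haeq s ⟨h1, by linarith⟩ v hv,
        ← haeq t ⟨by linarith, h3⟩ v hv]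
      exact hC s t v h1 h2 h3 hv
    · simp only
      rw [← haeq x ⟨by linarith [hx.1], hx.2⟩ v hv, ← haeq y ⟨by linarith [hy.1], hy.2⟩ v hv]
      exact hdec v hv hx hy hxy
  have hl : Ifun F a (mrear u) = Ifun F' a' (mrear U) :=
    Ifun_congr (fun x _ => by rw [mrear_congr hUeq]) (fun x _ => mrear_nonneg u x)
      (fun x hx v hv => ha0 x v (hIoo x hx) hv) (fun x hx => haeq x (hIoo x hx)) hFeq
  have hr : Ifun F a u = Ifun F' a' U :=
    Ifun_congr (fun x hx => hUeq (hIoo x hx)) (fun x hx => hnn x (hIoo x hx))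
      (fun x hx v hv => ha0 x v (hIoo x hx) hv) (fun x hx => haeq x (hIoo x hx)) hFeq
  rw [hl, hr]
  exact hmain
end
end

section
/- Let F ∈ 𝔉, let u ∈ W¹₁(-1,1) be nonnegative, let a : [-1,1] × [0,∞) → [0,∞) be continuous, and let W ⊆ [0,∞) be a closed set such that the set {v ∈ W : a(·,v) is not identically zero on [-1,1]} has Lebesgue measure zero. Then there exists a sequence of continuous weights b_ℓ : [-1,1] × [0,∞) → [0,∞), nondecreasing in ℓ and with b_ℓ ≤ a pointwise, such that: (1) for almost every v ≥ 0, b_ℓ(·,v) converges to a(·,v) uniformly on [-1,1]; (2) for each ℓ there is an open neighborhood of W (depending on ℓ) on which b_ℓ(x,v) = 0 for all x ∈ [-1,1]; (3) I(b_ℓ,u) → I(a,u) and I(b_ℓ,u*) → I(a,u*) as ℓ → ∞. -/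
open MeasureTheory Set Filter
open scoped ENNReal BigOperators NNReal

noncomputable section

/-- A function `f` has zero derivative a.e. on the preimage of a null set. -/
theorem volume_preimage_inter_deriv_ne_zero (f : ℝ → ℝ) {N : Set ℝ} (hN : volume N = 0) :
    volume {x | f x ∈ N ∧ deriv f x ≠ 0} = 0 := by
  let E : ℕ → Set ℝ := fun n =>
    {x | f x ∈ N ∧ ∀ y, dist y x < 1 / ((n : ℝ) + 1) → dist y x ≤ n * dist (f y) (f x)}
  have hsub : {x | f x ∈ N ∧ deriv f x ≠ 0} ⊆ ⋃ n, E n := by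
    rintro x ⟨hxN, hx⟩
    have hd : HasDerivAt f (deriv f x) x := (differentiableAt_of_deriv_ne_zero hx).hasDerivAt
    have hO := (hd.isTheta_sub hx).isBigO_symm.comp_tendsto
      (tendsto_id.prodMk (tendsto_pure.2 (Eventually.of_forall fun _ => rfl)) :
        Tendsto (fun y : ℝ => (y, x)) (nhds x) (nhds x ×ˢ pure x))
    obtain ⟨C, hC⟩ := hO.bound
    obtain ⟨ε, hε, hball⟩ := Metric.eventually_nhds_iff.1 hC
    obtain ⟨n₁, hn₁⟩ := exists_nat_gt C
    obtain ⟨n₂, hn₂⟩ := exists_nat_one_div_lt hε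
    refine mem_iUnion.2 ⟨max n₁ n₂, hxN, fun y hy => ?_⟩
    have hyε : dist y x < ε := by
      refine hy.trans_le (le_trans ?_ hn₂.le)
      exact one_div_le_one_div_of_le (by positivity) (by gcongr; exact le_max_right _ _)
    have h := hball hyε
    simp only [Function.comp_apply, ← dist_eq_norm] at h
    refine h.trans (mul_le_mul_of_nonneg_right (hn₁.le.trans ?_) dist_nonneg)
    exact_mod_cast le_max_left _ _
  refine measure_mono_null hsub (measure_iUnion_null fun n => ?_)
  refine measure_null_of_locally_null _ fun x _ => ?_
  have hr : (0 : ℝ) < 1 / ((n : ℝ) + 1) / 2 := by positivity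
  refine ⟨E n ∩ Metric.ball x (1 / ((n : ℝ) + 1) / 2),
    inter_mem_nhdsWithin _ (Metric.ball_mem_nhds x hr), ?_⟩
  set S := E n ∩ Metric.ball x (1 / ((n : ℝ) + 1) / 2) with hS
  have hdist : ∀ y ∈ S, ∀ z ∈ S, dist y z ≤ n * dist (f y) (f z) := by
    intro y hy z hz
    refine hz.1.2 y ?_
    have h₁ := Metric.mem_ball.1 hy.2
    have h₂ := Metric.mem_ball.1 hz.2
    linarith [dist_triangle_right y z x]
  have hinj : InjOn f S := fun y hy z hz h => by
    have := hdist y hy z hz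
    rw [h, dist_self, mul_zero] at this
    exact dist_le_zero.1 this
  have hlip : LipschitzOnWith (n : ℝ≥0) (Function.invFunOn f S) (f '' S) := by
    refine LipschitzOnWith.of_dist_le_mul ?_
    rintro _ ⟨y, hy, rfl⟩ _ ⟨z, hz, rfl⟩
    rw [hinj.leftInvOn_invFunOn hy, hinj.leftInvOn_invFunOn hz]
    simpa using hdist y hy z hz
  have h := hlip.hausdorffMeasure_image_le zero_le_one
  rw [hinj.leftInvOn_invFunOn.image_image, hausdorffMeasure_real,
    measure_mono_null (image_subset_iff.2 fun y hy => hy.1.1) hN, mul_zero] at h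
  exact le_antisymm h zero_le

theorem ContinuousOn.aemeasurable_comp {α β γ : Type*} [MeasurableSpace α] {μ : Measure α}
    [TopologicalSpace β] [MeasurableSpace β] [BorelSpace β]
    [TopologicalSpace γ] [MeasurableSpace γ] [BorelSpace γ] [Nonempty γ]
    {g : β → γ} {s : Set β} (hg : ContinuousOn g s) (hs : MeasurableSet s)
    {f : α → β} (hf : AEMeasurable f μ) (hfs : ∀ᵐ x ∂μ, f x ∈ s) :
    AEMeasurable (fun x => g (f x)) μ := by
  classical
  have hm : Measurable (s.piecewise g fun _ => Classical.arbitrary γ) :=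
    hg.measurable_piecewise continuousOn_const hs
  refine (hm.comp_aemeasurable hf).congr ?_
  filter_upwards [hfs] with x hx
  simp [hx]

/-- The cutoff `min (1, (ℓ d(v) - 1)₊)`. -/
def cutoff (d : ℝ → ℝ) (ℓ : ℕ) (v : ℝ) : ℝ := max 0 (min 1 (ℓ * d v - 1))

theorem cutoff_nonneg (d : ℝ → ℝ) (ℓ : ℕ) (v : ℝ) : 0 ≤ cutoff d ℓ v := le_max_left _ _

theorem cutoff_le_one (d : ℝ → ℝ) (ℓ : ℕ) (v : ℝ) : cutoff d ℓ v ≤ 1 :=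
  max_le zero_le_one (min_le_left _ _)

theorem cutoff_mono {d : ℝ → ℝ} {v : ℝ} (hd : 0 ≤ d v) : Monotone fun ℓ => cutoff d ℓ v := by
  intro k ℓ h
  dsimp only [cutoff]
  gcongr

theorem continuous_cutoff {d : ℝ → ℝ} (hd : Continuous d) (ℓ : ℕ) : Continuous (cutoff d ℓ) := by
  unfold cutoff
  fun_prop

theorem cutoff_eq_zero {d : ℝ → ℝ} {ℓ : ℕ} {v : ℝ} (h : ℓ * d v < 1) : cutoff d ℓ v = 0 :=
  max_eq_left ((min_le_right _ _).trans (by linarith))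

theorem eventually_cutoff_eq_one {d : ℝ → ℝ} {v : ℝ} (hd : 0 < d v) :
    ∀ᶠ ℓ in atTop, cutoff d ℓ v = 1 := by
  obtain ⟨n, hn⟩ := exists_nat_ge (2 / d v)
  filter_upwards [eventually_ge_atTop n] with ℓ hℓ
  have h : 2 ≤ ℓ * d v := by
    rw [← div_le_iff₀ hd]
    exact hn.trans (by exact_mod_cast hℓ)
  rw [cutoff, min_eq_left (by linarith), max_eq_right zero_le_one]

theorem exists_continuous_nonneg_zero_iff {W : Set ℝ} (hW : IsClosed W) :
    ∃ d : ℝ → ℝ, Continuous d ∧ (∀ v, 0 ≤ d v) ∧ ∀ v, d v = 0 ↔ v ∈ W := by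
  rcases W.eq_empty_or_nonempty with rfl | hne
  · exact ⟨fun _ => 1, continuous_const, fun _ => zero_le_one, by simp⟩
  · exact ⟨fun v => Metric.infDist v W, Metric.continuous_infDist_pt W,
      fun _ => Metric.infDist_nonneg, fun v => (hW.mem_iff_infDist_zero hne).symm⟩

theorem Weight.mul_cutoff {a : ℝ → ℝ → ℝ} (ha : Weight a) {d : ℝ → ℝ} (hd : Continuous d)
    (ℓ : ℕ) : Weight fun x v => a x v * cutoff d ℓ v :=
  ⟨ha.1.mul ((continuous_cutoff hd ℓ).comp continuous_snd).continuousOn,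
    fun x v hx hv => mul_nonneg (ha.2 x v hx hv) (cutoff_nonneg d ℓ v)⟩

theorem aemeasurable_energy_density {F b : ℝ → ℝ → ℝ} (hF : MemFrakF F) (hb : Weight b)
    {w : ℝ → ℝ} (hw : AEMeasurable w (volume.restrict (Icc (-1 : ℝ) 1)))
    (hw0 : ∀ x ∈ Icc (-1 : ℝ) 1, 0 ≤ w x) :
    AEMeasurable (fun x => ENNReal.ofReal (F (w x) (b x (w x) * |deriv w x|)))
      (volume.restrict (Icc (-1 : ℝ) 1)) := by
  have hmem := ae_restrict_mem (μ := (volume : Measure ℝ))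
    (measurableSet_Icc (a := (-1 : ℝ)) (b := 1))
  have hbw : AEMeasurable (fun x => b x (w x)) (volume.restrict (Icc (-1 : ℝ) 1)) := by
    refine ContinuousOn.aemeasurable_comp (f := fun x => (x, w x)) hb.1
      (measurableSet_Icc.prod measurableSet_Ici) (aemeasurable_id.prodMk hw) ?_
    filter_upwards [hmem] with x hx using ⟨hx, hw0 x hx⟩
  refine ENNReal.measurable_ofReal.comp_aemeasurable ?_
  refine ContinuousOn.aemeasurable_comp (f := fun x => (w x, b x (w x) * |deriv w x|)) hF.1
    (measurableSet_Ici.prod measurableSet_Ici)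
    (hw.prodMk (hbw.mul (measurable_deriv w).abs.aemeasurable)) ?_
  filter_upwards [hmem] with x hx
  exact ⟨hw0 x hx, mul_nonneg (hb.2 x _ hx (hw0 x hx)) (abs_nonneg _)⟩

theorem tendsto_Ifun_mul_cutoff {a F : ℝ → ℝ → ℝ} (ha : Weight a) (hF : MemFrakF F) {W : Set ℝ}
    (hWzero : volume {v ∈ W | ∃ x ∈ Icc (-1 : ℝ) 1, a x v ≠ 0} = 0) {d : ℝ → ℝ}
    (hd : Continuous d) (hd0 : ∀ v, 0 ≤ d v) (hdW : ∀ v, d v = 0 ↔ v ∈ W)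
    {w : ℝ → ℝ} (hw : AEMeasurable w (volume.restrict (Icc (-1 : ℝ) 1)))
    (hw0 : ∀ x ∈ Icc (-1 : ℝ) 1, 0 ≤ w x) :
    Tendsto (fun ℓ => Ifun F (fun x v => a x v * cutoff d ℓ v) w) atTop (nhds (Ifun F a w)) := by
  have hmem := ae_restrict_mem (μ := (volume : Measure ℝ))
    (measurableSet_Icc (a := (-1 : ℝ)) (b := 1))
  refine lintegral_tendsto_of_tendsto_of_monotone
    (fun ℓ => aemeasurable_energy_density hF (ha.mul_cutoff hd ℓ) hw hw0) ?_ ?_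
  · filter_upwards [hmem] with x hx k ℓ hkl
    have hax := ha.2 x _ hx (hw0 x hx)
    refine ENNReal.ofReal_le_ofReal (hF.2.2.2 _ (hw0 x hx) ?_ ?_ ?_)
    · exact mul_nonneg (mul_nonneg hax (cutoff_nonneg _ _ _)) (abs_nonneg _)
    · exact mul_nonneg (mul_nonneg hax (cutoff_nonneg _ _ _)) (abs_nonneg _)
    · gcongr
      exact cutoff_mono (hd0 _) hkl
  · have hnull : ∀ᵐ x ∂(volume.restrict (Icc (-1 : ℝ) 1)),
        ¬ (w x ∈ {v ∈ W | ∃ x ∈ Icc (-1 : ℝ) 1, a x v ≠ 0} ∧ deriv w x ≠ 0) :=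
      ae_restrict_of_ae
        (measure_eq_zero_iff_ae_notMem.1 (volume_preimage_inter_deriv_ne_zero w hWzero))
    filter_upwards [hmem, hnull] with x hx hxn
    refine tendsto_const_nhds.congr' ?_
    by_cases hxW : w x ∈ W
    · refine Eventually.of_forall fun ℓ => ?_
      by_cases hdx : deriv w x = 0
      · simp [hdx]
      · have hax : a x (w x) = 0 := by
          by_contra hne
          exact hxn ⟨⟨hxW, x, hx, hne⟩, hdx⟩
        simp [hax]
    · have hpos : 0 < d (w x) := (hd0 _).lt_of_ne fun h => hxW ((hdW _).1 h.symm)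
      filter_upwards [eventually_cutoff_eq_one hpos] with ℓ hℓ
      rw [hℓ, mul_one]

theorem MemW11.continuousOn {u : ℝ → ℝ} (hu : MemW11 u) : ContinuousOn u (Icc (-1) 1) := by
  have hI : uIcc (-1 : ℝ) 1 = Icc (-1) 1 := uIcc_of_le (by norm_num)
  have h := intervalIntegral.continuousOn_primitive_interval (μ := volume) (hI ▸ hu.1)
  rw [hI] at h
  exact (continuousOn_const.add h).congr hu.2

theorem measurable_mrear (u : ℝ → ℝ) : Measurable (mrear u) := by
  have hanti : Antitone fun t : ℝ => (volume {y ∈ Icc (-1 : ℝ) 1 | u y > t}).toReal := by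
    intro s t hst
    refine ENNReal.toReal_mono ?_ (measure_mono fun y hy => ⟨hy.1, hst.trans_lt hy.2⟩)
    exact measure_ne_top_of_subset (sep_subset _ _) (by simp)
  have hset : MeasurableSet {p : ℝ × ℝ |
      p.1 ∈ Icc (1 - (volume {y ∈ Icc (-1 : ℝ) 1 | u y > p.2}).toReal) 1} :=
    (measurableSet_le (measurable_const.sub (hanti.measurable.comp measurable_snd))
      measurable_fst).inter (measurableSet_le measurable_fst measurable_const)
  have h : StronglyMeasurable (Function.uncurry fun x t : ℝ =>
      (Icc (1 - (volume {y ∈ Icc (-1 : ℝ) 1 | u y > t}).toReal) 1).indicator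
        (fun _ => (1 : ℝ)) x) :=
    (measurable_const.indicator hset).stronglyMeasurable
  exact (h.integral_prod_right (ν := volume.restrict (Ioi 0))).measurable

/-- approximation of the weight by weights vanishing near a closed set `W` on
which `a(·,v) ≡ 0` for a.e. `v`, with convergence of the energies. -/
theorem stmt14 (a F : ℝ → ℝ → ℝ) (ha : Weight a) (hF : MemFrakF F)
    (u : ℝ → ℝ) (hu : MemW11 u) (hnn : ∀ x ∈ Icc (-1 : ℝ) 1, 0 ≤ u x)
    (W : Set ℝ) (hWclosed : IsClosed W) (hWsub : W ⊆ Ici (0 : ℝ))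
    (hWzero : volume {v ∈ W | ∃ x ∈ Icc (-1 : ℝ) 1, a x v ≠ 0} = 0) :
    ∃ b : ℕ → ℝ → ℝ → ℝ,
      (∀ ℓ, Weight (b ℓ)) ∧
      (∀ ℓ, ∀ x ∈ Icc (-1 : ℝ) 1, ∀ v : ℝ, 0 ≤ v → b ℓ x v ≤ b (ℓ + 1) x v) ∧
      (∀ ℓ, ∀ x ∈ Icc (-1 : ℝ) 1, ∀ v : ℝ, 0 ≤ v → b ℓ x v ≤ a x v) ∧
      (∀ᵐ v ∂(volume.restrict (Ici (0 : ℝ))),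
        TendstoUniformlyOn (fun ℓ x => b ℓ x v) (fun x => a x v) atTop (Icc (-1 : ℝ) 1)) ∧
      (∀ ℓ, ∃ U : Set ℝ, IsOpen U ∧ W ⊆ U ∧ ∀ v ∈ U, ∀ x ∈ Icc (-1 : ℝ) 1, b ℓ x v = 0) ∧
      Tendsto (fun ℓ => Ifun F (b ℓ) u) atTop (nhds (Ifun F a u)) ∧
      Tendsto (fun ℓ => Ifun F (b ℓ) (mrear u)) atTop (nhds (Ifun F a (mrear u))) := by
  obtain ⟨d, hd, hd0, hdW⟩ := exists_continuous_nonneg_zero_iff hWclosed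
  refine ⟨fun ℓ x v => a x v * cutoff d ℓ v, ha.mul_cutoff hd, ?_, ?_, ?_, ?_, ?_, ?_⟩
  · intro ℓ x hx v hv
    exact mul_le_mul_of_nonneg_left (cutoff_mono (hd0 v) ℓ.le_succ) (ha.2 x v hx hv)
  · intro ℓ x hx v hv
    exact mul_le_of_le_one_right (ha.2 x v hx hv) (cutoff_le_one d ℓ v)
  · filter_upwards [ae_restrict_of_ae (measure_eq_zero_iff_ae_notMem.1 hWzero)] with v hv
    have heq : ∀ᶠ ℓ in atTop, ∀ x ∈ Icc (-1 : ℝ) 1, a x v * cutoff d ℓ v = a x v := by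
      by_cases hvW : v ∈ W
      · refine Eventually.of_forall fun ℓ x hx => ?_
        have hax : a x v = 0 := by
          by_contra hne
          exact hv ⟨hvW, x, hx, hne⟩
        simp [hax]
      · have hpos : 0 < d v := (hd0 v).lt_of_ne fun h => hvW ((hdW v).1 h.symm)
        filter_upwards [eventually_cutoff_eq_one hpos] with ℓ hℓ x _
        rw [hℓ, mul_one]
    refine Metric.tendstoUniformlyOn_iff.2 fun ε hε => ?_
    filter_upwards [heq] with ℓ hℓ x hx
    simpa [hℓ x hx] using hε
  · intro ℓ
    refine ⟨{v | ℓ * d v < 1}, isOpen_lt (by fun_prop) continuous_const, fun v hv => ?_, ?_⟩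
    · simp [(hdW v).2 hv]
    · intro v hv x _
      simp [cutoff_eq_zero hv]
  · exact tendsto_Ifun_mul_cutoff ha hF hWzero hd hd0 hdW
      (hu.continuousOn.aemeasurable measurableSet_Icc) hnn
  · exact tendsto_Ifun_mul_cutoff ha hF hWzero hd hd0 hdW
      (measurable_mrear u).aemeasurable fun x _ => mrear_nonneg u x
end
end
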